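/- Let F_q be a finite field, let S = {α_1, …, α_n} ⊆ F_q be a set of n distinct elements, and let C = {(aα_1 + b, …, aα_n + b) : a, b ∈ F_q} be the 2-dimensional Reed–Solomon code with evaluation points (α_1, …, α_n). Suppose m ≥ 1 is an integer such that |δS ∩ (S + γ)| ≤ m for every pair (δ, γ) ∈ F_q × F_q with (δ, γ) ≠ (1, 0), where δS = {δs : s ∈ S} and S + γ = {s + γ : s ∈ S}. Then the minimum insdel distance of C is at least 2n − 2m. -/

import Mathlib

open Pointwise

/-- `b` is obtained from `a` by a single symbol insertion or deletion. -/
def InsDelStep {α : Type*} (a b : List α) : Prop :=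
  (∃ (l r : List α) (x : α), a = l ++ x :: r ∧ b = l ++ r) ∨
  (∃ (l r : List α) (x : α), b = l ++ x :: r ∧ a = l ++ r)

/-- The insdel distance: the minimum number of single-symbol insertions and
deletions needed to transform `a` into `b`. -/
noncomputable def insdelDist {α : Type*} (a b : List α) : ℕ :=
  sInf {m : ℕ | ∃ c : ℕ → List α, c 0 = a ∧ c m = b ∧ ∀ i < m, InsDelStep (c i) (c (i + 1))}

/-- The minimum insdel distance of a code `C ⊆ F^n`. -/
noncomputable def codeInsdelDist {F : Type*} {n : ℕ} (C : Set (Fin n → F)) : ℕ :=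
  sInf {m : ℕ | ∃ c1 ∈ C, ∃ c2 ∈ C, c1 ≠ c2 ∧ m = insdelDist (List.ofFn c1) (List.ofFn c2)}

theorem InsDelStep.symm {α : Type*} {a b : List α} (h : InsDelStep a b) : InsDelStep b a :=
  Or.symm h

theorem InsDelStep.reflTransGen {α : Type*} (a b : List α) :
    Relation.ReflTransGen InsDelStep a b := by
  have to_nil : ∀ a : List α, Relation.ReflTransGen InsDelStep a [] := by
    intro a
    induction a with
    | nil => exact .refl
    | cons x l ih => exact .head (Or.inl ⟨[], l, x, rfl, rfl⟩) ih
  have from_nil : Relation.ReflTransGen InsDelStep [] b := by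
    induction b with
    | nil => exact .refl
    | cons x l ih => exact .tail ih (Or.inr ⟨[], l, x, rfl, rfl⟩)
  exact (to_nil a).trans from_nil

theorem exists_insDelStep_chain {α : Type*} (a b : List α) :
    ∃ (m : ℕ) (c : ℕ → List α), c 0 = a ∧ c m = b ∧ ∀ i < m, InsDelStep (c i) (c (i + 1)) := by
  induction InsDelStep.reflTransGen a b with
  | refl => exact ⟨0, fun _ => a, rfl, rfl, by simp⟩
  | @tail b d _ hstep ih =>
    obtain ⟨m, c, h0, hm, hc⟩ := ih
    refine ⟨m + 1, fun i => if i ≤ m then c i else d, by simpa using h0, by simp, ?_⟩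
    intro i hi
    rcases Nat.lt_succ_iff_lt_or_eq.mp hi with h | rfl
    · simpa [h.le, Nat.succ_le_of_lt h] using hc i h
    · simpa [hm] using hstep

/-- A single step shortens a common subsequence by at most one symbol. -/
theorem InsDelStep.exists_common_sublist {α : Type*} {a x y : List α} (h : InsDelStep x y)
    {L : List α} (ha : L.Sublist a) (hx : L.Sublist x) :
    ∃ L' : List α, L'.Sublist a ∧ L'.Sublist y ∧
      2 * L.length + y.length ≤ 2 * L'.length + x.length + 1 := by
  rcases h with ⟨l, r, z, rfl, rfl⟩ | ⟨l, r, z, rfl, rfl⟩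
  · obtain ⟨L₁, L₂, rfl, h₁, h₂⟩ := List.sublist_append_iff.mp hx
    refine ⟨L₁ ++ L₂.tail, ?_, h₁.append (by simpa using h₂.tail), ?_⟩
    · exact ((List.Sublist.refl L₁).append (List.tail_sublist L₂)).trans ha
    · simp only [List.length_append, List.length_tail, List.length_cons]
      omega
  · refine ⟨L, ha, hx.trans ((List.Sublist.refl l).append (List.sublist_cons_self z r)), ?_⟩
    simp only [List.length_append, List.length_cons]
    omega

theorem exists_common_sublist_of_chain {α : Type*} (c : ℕ → List α) (m : ℕ)
    (hc : ∀ i < m, InsDelStep (c i) (c (i + 1))) :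
    ∃ L : List α, L.Sublist (c 0) ∧ L.Sublist (c m) ∧
      (c 0).length + (c m).length ≤ 2 * L.length + m := by
  induction m with
  | zero => exact ⟨c 0, .refl _, .refl _, by omega⟩
  | succ m ih =>
    obtain ⟨L, h0, hm, hlen⟩ := ih fun i hi => hc i (by omega)
    obtain ⟨L', h0', hm', hlen'⟩ := (hc m (by omega)).exists_common_sublist h0 hm
    exact ⟨L', h0', hm', by omega⟩

theorem exists_common_sublist_insdelDist {α : Type*} (a b : List α) :
    ∃ L : List α, L.Sublist a ∧ L.Sublist b ∧
      a.length + b.length ≤ 2 * L.length + insdelDist a b := by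
  obtain ⟨c, h0, hm, hc⟩ := Nat.sInf_mem
    (s := {m : ℕ | ∃ c : ℕ → List α, c 0 = a ∧ c m = b ∧ ∀ i < m, InsDelStep (c i) (c (i + 1))})
    (exists_insDelStep_chain a b)
  have h := exists_common_sublist_of_chain c _ hc
  rwa [h0, hm] at h

theorem exists_sublist_finRange_of_sublist_ofFn {α : Type*} {n : ℕ} {c : Fin n → α}
    {L : List α} (h : L.Sublist (List.ofFn c)) :
    ∃ J : List (Fin n), J.Nodup ∧ L = J.map c := by
  rw [List.ofFn_eq_map, List.sublist_map_iff] at h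
  obtain ⟨J, hJ, rfl⟩ := h
  exact ⟨J, (List.nodup_finRange n).sublist hJ, rfl⟩

/-- A common subsequence of two affine codewords, the second one non-constant, is no longer than
the intersection of a dilate and a translate of the evaluation set. -/
theorem length_common_sublist_affine_le {F : Type*} [Field F] {n : ℕ}
    {α : Fin n → F} (hα : Function.Injective α) {a b a' b' : F} (ha' : a' ≠ 0)
    {L : List F} (h₁ : L.Sublist (List.ofFn fun i => a * α i + b))
    (h₂ : L.Sublist (List.ofFn fun i => a' * α i + b')) :
    L.length ≤ (((a / a') • Set.range α) ∩
      ((fun x => x + (b' - b) / a') '' Set.range α)).ncard := by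
  classical
  obtain ⟨J, hJ, rfl⟩ := exists_sublist_finRange_of_sublist_ofFn h₂
  have hinj : Function.Injective fun j => α j + (b' - b) / a' :=
    (add_left_injective _).comp hα
  rw [List.length_map, ← List.toFinset_card_of_nodup hJ,
    ← Finset.card_image_of_injective _ hinj, ← Set.ncard_coe_finset]
  refine Set.ncard_le_ncard ?_ (((Set.finite_range α).image _).inter_of_right _)
  intro x hx
  obtain ⟨j, hj, rfl⟩ := Finset.mem_image.mp hx
  refine ⟨?_, α j, ⟨j, rfl⟩, rfl⟩
  obtain ⟨i, hi⟩ := (List.mem_ofFn' _ _).mp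
    (h₁.subset (List.mem_map_of_mem (List.mem_toFinset.mp hj)))
  refine ⟨α i, ⟨i, rfl⟩, ?_⟩
  simp only [smul_eq_mul]
  field_simp
  linear_combination hi

/-- if `S = {α 0, …, α (n-1)}` is a set of `n` distinct elements of `F_q` and
for some `m ≥ 1` one has `|δS ∩ (S + γ)| ≤ m` for every `(δ, γ) ≠ (1, 0)`, then the
2-dimensional Reed–Solomon code `{(aα 0 + b, …, aα (n-1) + b) : a, b ∈ F_q}` has minimum
insdel distance at least `2n - 2m`. -/
theorem rs_insdel_distance_of_small_intersections
    {F : Type*} [Field F] [Fintype F] {n : ℕ}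
    (α : Fin n → F) (hα : Function.Injective α)
    (S : Set F) (hS : S = Set.range α)
    (C : Set (Fin n → F)) (hC : C = {c | ∃ a b : F, c = fun i => a * α i + b})
    (m : ℕ) (hm : 1 ≤ m)
    (hint : ∀ δ γ : F, (δ, γ) ≠ (1, 0) →
      ((δ • S) ∩ ((fun x => x + γ) '' S)).ncard ≤ m) :
    2 * n - 2 * m ≤ codeInsdelDist C := by
  rcases Nat.eq_zero_or_pos n with rfl | hn
  · simp
  subst hS hC
  have bound : ∀ a b a' b' : F, a' ≠ 0 →
      (fun i => a * α i + b) ≠ (fun i => a' * α i + b') → ∀ L : List F,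
      L.Sublist (List.ofFn fun i => a * α i + b) →
      L.Sublist (List.ofFn fun i => a' * α i + b') → L.length ≤ m := by
    intro a b a' b' ha' hne L h₁ h₂
    refine (length_common_sublist_affine_le hα ha' h₁ h₂).trans (hint _ _ fun h => hne ?_)
    obtain ⟨hδ, hγ⟩ := Prod.mk.inj h
    rw [div_eq_one_iff_eq ha'] at hδ
    rw [div_eq_zero_iff, or_iff_left ha', sub_eq_zero] at hγ
    rw [hδ, hγ]
  refine le_csInf ?_ ?_
  · refine ⟨_, _, ⟨0, 0, rfl⟩, _, ⟨0, 1, rfl⟩, fun h => ?_, rfl⟩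
    simpa using congrFun h ⟨0, hn⟩
  · rintro _ ⟨_, ⟨a, b, rfl⟩, _, ⟨a', b', rfl⟩, hne, rfl⟩
    obtain ⟨L, h₁, h₂, hlen⟩ := exists_common_sublist_insdelDist
      (List.ofFn fun i => a * α i + b) (List.ofFn fun i => a' * α i + b')
    have hL : L.length ≤ m := by
      by_cases ha' : a' = 0
      · by_cases ha : a = 0
        · subst ha ha'
          cases L with
          | nil => simp
          | cons x L =>
            have hx₁ := h₁.subset List.mem_cons_self
            have hx₂ := h₂.subset List.mem_cons_self
            obtain ⟨i, hi⟩ := (List.mem_ofFn' _ _).mp hx₁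
            obtain ⟨j, hj⟩ := (List.mem_ofFn' _ _).mp hx₂
            simp only [zero_mul, zero_add] at hi hj hne
            exact absurd (by rw [hi, hj]) hne
        · exact bound a' b' a b ha hne.symm L h₂ h₁
      · exact bound a b a' b' ha' hne L h₁ h₂
    simp only [List.length_ofFn] at hlen
    omega
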